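/- arXiv:1902.09353 — 5 statements merged into one kernel-verified Lean document; each statement's English description precedes it below -/
import Mathlib

section
/- Let L be a p×p real lower triangular matrix with unit diagonal entries, D a p×p diagonal matrix with strictly positive diagonal entries, Ω = L D⁻¹ Lᵀ, and let Y₁,…,Yₙ ∈ ℝ^p with sample covariance S = (1/n) ∑_{k=1}^n Yₖ Yₖᵀ. Let U be a symmetric p×p matrix and α₁,…,α_p ∈ ℝ. Then [∏_{k=1}^n (2π)^{-p/2} det(Ω)^{1/2} exp(−½ Yₖᵀ Ω Yₖ)] · exp(−½ tr(Ω U)) ∏_{i=1}^p D_{ii}^{−α_i/2} = (2π)^{−np/2} · exp(−½ tr(Ω (U + nS))) · ∏_{i=1}^p D_{ii}^{−(α_i+n)/2}; that is, the product of the Gaussian likelihood and the unnormalized DAG-Wishart prior kernel with parameters (U, α) equals (2π)^{−np/2} times the unnormalized DAG-Wishart kernel with updated parameters (U + nS, α + n). -/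
open Matrix

/-- The precision matrix `Ω = L D⁻¹ Lᵀ` built from the Cholesky parameter `(d, L)`. -/
noncomputable def precisionOf (p : ℕ) (L : Matrix (Fin p) (Fin p) ℝ) (d : Fin p → ℝ) :
    Matrix (Fin p) (Fin p) ℝ :=
  L * (Matrix.diagonal d)⁻¹ * Lᵀ

/-- The sample covariance matrix `S = (1/n) ∑ₖ Yₖ Yₖᵀ`. -/
noncomputable def sampleCov (p n : ℕ) (Y : Fin n → Fin p → ℝ) :
    Matrix (Fin p) (Fin p) ℝ :=
  (1 / (n : ℝ)) • ∑ k, Matrix.vecMulVec (Y k) (Y k)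

theorem precisionOf_det (p : ℕ) (L : Matrix (Fin p) (Fin p) ℝ) (d : Fin p → ℝ)
    (hL : ∀ i j, i < j → L i j = 0) (hdiag : ∀ i, L i i = 1) :
    (precisionOf p L d).det = (∏ i, d i)⁻¹ := by
  have hdet : L.det = 1 := by
    rw [Matrix.det_of_isLowerTriangular L fun i j h => hL i j h]
    simp [hdiag]
  simp [precisionOf, Matrix.det_nonsing_inv, hdet]

theorem natCast_smul_sampleCov (p n : ℕ) (hn : 0 < n) (Y : Fin n → Fin p → ℝ) :
    (n : ℝ) • sampleCov p n Y = ∑ k, Matrix.vecMulVec (Y k) (Y k) := by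
  have hn' : (n : ℝ) ≠ 0 := by positivity
  rw [sampleCov, smul_smul, mul_one_div_cancel hn', one_smul]

theorem trace_mul_natCast_smul_sampleCov (p n : ℕ) (hn : 0 < n) (Y : Fin n → Fin p → ℝ)
    (M : Matrix (Fin p) (Fin p) ℝ) :
    (M * ((n : ℝ) • sampleCov p n Y)).trace = ∑ k, Y k ⬝ᵥ (M *ᵥ Y k) := by
  rw [natCast_smul_sampleCov p n hn, Matrix.mul_sum, Matrix.trace_sum]
  refine Finset.sum_congr rfl fun k _ => ?_
  rw [Matrix.mul_vecMulVec, Matrix.trace_vecMulVec, dotProduct_comm]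

/-- The product of the Gaussian likelihood of `Y₁, …, Yₙ` under `N_p(0, Ω⁻¹)` with
`Ω = L D⁻¹ Lᵀ` and the unnormalized DAG-Wishart kernel with parameters `(U, α)`
equals `(2π)^(-np/2)` times the unnormalized DAG-Wishart kernel with updated
parameters `(U + nS, α + n)`. -/
theorem gaussian_likelihood_mul_dagWishart_kernel (p n : ℕ) (hn : 0 < n)
    (L : Matrix (Fin p) (Fin p) ℝ) (d : Fin p → ℝ)
    (hL : ∀ i j, i < j → L i j = 0) (hdiag : ∀ i, L i i = 1) (hd : ∀ i, 0 < d i)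
    (Y : Fin n → Fin p → ℝ) (U : Matrix (Fin p) (Fin p) ℝ) (hU : Uᵀ = U)
    (α : Fin p → ℝ) :
    (∏ k, ((2 * Real.pi) ^ (-(p : ℝ) / 2) *
          (precisionOf p L d).det ^ ((1 : ℝ) / 2) *
          Real.exp (-(1 / 2) * (Y k ⬝ᵥ ((precisionOf p L d) *ᵥ Y k))))) *
        (Real.exp (-(1 / 2) * ((precisionOf p L d) * U).trace) *
          ∏ i, d i ^ (-(α i) / 2))
      = (2 * Real.pi) ^ (-((n : ℝ) * p) / 2) *
          Real.exp (-(1 / 2) *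
            ((precisionOf p L d) * (U + (n : ℝ) • sampleCov p n Y)).trace) *
          ∏ i, d i ^ (-(α i + n) / 2) := by
  have hpi : (0 : ℝ) ≤ 2 * Real.pi := by positivity
  have hconst : ((2 * Real.pi) ^ (-(p : ℝ) / 2)) ^ n = (2 * Real.pi) ^ (-((n : ℝ) * p) / 2) := by
    rw [← Real.rpow_mul_natCast hpi]
    congr 1
    ring
  have hdet : ((precisionOf p L d).det ^ ((1 : ℝ) / 2)) ^ n * ∏ i, d i ^ (-(α i) / 2) =
      ∏ i, d i ^ (-(α i + n) / 2) := by
    rw [precisionOf_det p L d hL hdiag, ← Finset.prod_inv_distrib,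
      ← Real.finsetProd_rpow _ _ fun i _ => inv_nonneg.2 (hd i).le, ← Finset.prod_pow,
      ← Finset.prod_mul_distrib]
    refine Finset.prod_congr rfl fun i _ => ?_
    rw [Real.inv_rpow (hd i).le, ← Real.rpow_neg (hd i).le, ← Real.rpow_mul_natCast (hd i).le,
      ← Real.rpow_add (hd i)]
    congr 1
    ring
  rw [Finset.prod_mul_distrib, Finset.prod_const, Finset.card_univ, Fintype.card_fin, mul_pow,
    hconst, ← Real.exp_sum, ← Finset.mul_sum, Matrix.mul_add, Matrix.trace_add,
    trace_mul_natCast_smul_sampleCov p n hn, mul_add, Real.exp_add, ← hdet]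
  ring
end

section
/- Let B be a real symmetric positive definite (ν+1)×(ν+1) matrix written in block form B = [[b₀, uᵀ],[u, M]] with b₀ ∈ ℝ, u ∈ ℝ^ν, and M a ν×ν matrix, and let a > 0. Then the function g(d, l) = d^{−a/2} exp(−(b₀ + 2 uᵀ l + lᵀ M l)/(2d)) on (0,∞) × ℝ^ν attains its maximum uniquely at l = −M⁻¹ u and d = (b₀ − uᵀ M⁻¹ u)/a. -/
open Matrix

/-- The `(ν+1) × (ν+1)` block matrix `B = [[b₀, uᵀ], [u, M]]`. -/
def blockB (ν : ℕ) (b₀ : ℝ) (u : Fin ν → ℝ) (M : Matrix (Fin ν) (Fin ν) ℝ) :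
    Matrix (Fin 1 ⊕ Fin ν) (Fin 1 ⊕ Fin ν) ℝ :=
  Matrix.fromBlocks (Matrix.of fun _ _ => b₀) (Matrix.of fun _ j => u j)
    (Matrix.of fun i _ => u i) M

/-- The per-node factor `g(d, l) = d^(-a/2) * exp (-(b₀ + 2 uᵀ l + lᵀ M l)/(2d))`
of the DAG-Wishart posterior density. -/
noncomputable def nodeFactor (ν : ℕ) (a b₀ : ℝ) (u : Fin ν → ℝ)
    (M : Matrix (Fin ν) (Fin ν) ℝ) (d : ℝ) (l : Fin ν → ℝ) : ℝ :=
  d ^ (-a / 2) * Real.exp (-(b₀ + 2 * (u ⬝ᵥ l) + l ⬝ᵥ (M *ᵥ l)) / (2 * d))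

theorem blockB_dotProduct_mulVec (ν : ℕ) (b₀ : ℝ) (u : Fin ν → ℝ)
    (M : Matrix (Fin ν) (Fin ν) ℝ) (c : ℝ) (l : Fin ν → ℝ) :
    Sum.elim (fun _ : Fin 1 => c) l ⬝ᵥ (blockB ν b₀ u M *ᵥ Sum.elim (fun _ : Fin 1 => c) l) =
      c ^ 2 * b₀ + 2 * c * (u ⬝ᵥ l) + l ⬝ᵥ (M *ᵥ l) := by
  have h₁ : (Matrix.of fun (_ : Fin 1) (_ : Fin 1) => b₀) *ᵥ (fun _ => c) = fun _ => b₀ * c := by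
    ext; simp [mulVec, dotProduct]
  have h₂ : (Matrix.of fun (_ : Fin 1) j => u j) *ᵥ l = fun _ => u ⬝ᵥ l := by
    ext; simp [mulVec, dotProduct]
  have h₃ : (Matrix.of fun i (_ : Fin 1) => u i) *ᵥ (fun _ => c) = c • u := by
    ext; simp [mulVec, dotProduct, mul_comm]
  have h₄ (x : ℝ) : (fun _ : Fin 1 => c) ⬝ᵥ (fun _ => x) = c * x := by simp [dotProduct]
  rw [blockB, fromBlocks_mulVec, sumElim_dotProduct_sumElim]
  simp only [Sum.elim_comp_inl, Sum.elim_comp_inr, h₁, h₂, h₃, dotProduct_add, h₄,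
    dotProduct_smul, smul_eq_mul, dotProduct_comm l u]
  ring

theorem add_two_mul_dotProduct_add_eq {ι : Type*} [Fintype ι] [DecidableEq ι]
    {M : Matrix ι ι ℝ} (hM : M.PosDef) (b₀ : ℝ) (u l : ι → ℝ) :
    b₀ + 2 * (u ⬝ᵥ l) + l ⬝ᵥ (M *ᵥ l) =
      b₀ - u ⬝ᵥ (M⁻¹ *ᵥ u) + (l + M⁻¹ *ᵥ u) ⬝ᵥ (M *ᵥ (l + M⁻¹ *ᵥ u)) := by
  have hw : M *ᵥ (M⁻¹ *ᵥ u) = u := by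
    rw [mulVec_mulVec, mul_nonsing_inv _ ((isUnit_iff_isUnit_det M).mp hM.isUnit), one_mulVec]
  have hsymm : (M⁻¹ *ᵥ u) ⬝ᵥ (M *ᵥ l) = u ⬝ᵥ l := by
    have hT : Mᵀ = M := by simpa using hM.isHermitian.eq
    rw [dotProduct_mulVec, ← mulVec_transpose, hT, hw]
  rw [mulVec_add, hw, add_dotProduct, dotProduct_add, dotProduct_add, hsymm,
    dotProduct_comm l u, dotProduct_comm (M⁻¹ *ᵥ u) u]
  ring

theorem rpow_mul_exp_neg_div_eq_exp {a d : ℝ} (hd : 0 < d) (q : ℝ) :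
    d ^ (-a / 2) * Real.exp (-q / (2 * d)) = Real.exp (-a / 2 * Real.log d - q / (2 * d)) := by
  rw [Real.rpow_def_of_pos hd, ← Real.exp_add]
  congr 1
  ring

theorem rpow_mul_exp_neg_div_le {a d s q : ℝ} (ha : 0 < a) (hd : 0 < d) (hs : 0 < s)
    (hq : s ≤ q) :
    d ^ (-a / 2) * Real.exp (-q / (2 * d)) ≤
        (s / a) ^ (-a / 2) * Real.exp (-s / (2 * (s / a))) ∧
      (d ^ (-a / 2) * Real.exp (-q / (2 * d)) =
          (s / a) ^ (-a / 2) * Real.exp (-s / (2 * (s / a))) ↔ d = s / a ∧ q = s) := by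
  have hsa : 0 < s / a := div_pos hs ha
  set t := s / a / d with ht_def
  have ht : 0 < t := div_pos hsa hd
  have hlog : Real.log t = Real.log (s / a) - Real.log d := Real.log_div hsa.ne' hd.ne'
  have hgap : (-a / 2 * Real.log (s / a) - s / (2 * (s / a))) -
      (-a / 2 * Real.log d - q / (2 * d)) =
        a / 2 * (t - 1 - Real.log t) + (q - s) / (2 * d) := by
    rw [hlog, ht_def]
    field_simp
    ring
  have hlin : 0 ≤ a / 2 * (t - 1 - Real.log t) :=
    mul_nonneg (by positivity) (by linarith [Real.log_le_sub_one_of_pos ht])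
  have hquad : 0 ≤ (q - s) / (2 * d) := div_nonneg (by linarith) (by positivity)
  rw [rpow_mul_exp_neg_div_eq_exp hd, rpow_mul_exp_neg_div_eq_exp hsa, Real.exp_le_exp,
    Real.exp_eq_exp]
  refine ⟨by linarith, fun h => ?_, ?_⟩
  · have hlin0 : a / 2 * (t - 1 - Real.log t) = 0 := by linarith
    have hquad0 : (q - s) / (2 * d) = 0 := by linarith
    constructor
    · by_contra hne
      have ht1 : t ≠ 1 := fun h1 => hne ((div_eq_one_iff_eq hd.ne').mp h1).symm
      have : 0 < a / 2 * (t - 1 - Real.log t) :=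
        mul_pos (by positivity) (by linarith [Real.log_lt_sub_one_of_pos ht ht1])
      linarith
    · rcases div_eq_zero_iff.mp hquad0 with h0 | h0 <;> linarith
  · rintro ⟨rfl, rfl⟩
    rfl

/-- For a symmetric positive definite block matrix `B = [[b₀, uᵀ], [u, M]]` and `a > 0`,
the function `g(d, l) = d^(-a/2) * exp (-(b₀ + 2 uᵀ l + lᵀ M l)/(2d))` on `(0,∞) × ℝ^ν`
attains its maximum uniquely at `l = -M⁻¹ u` and `d = (b₀ - uᵀ M⁻¹ u)/a`. -/
theorem nodeFactor_max (ν : ℕ) (b₀ : ℝ) (u : Fin ν → ℝ)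
    (M : Matrix (Fin ν) (Fin ν) ℝ) (a : ℝ) (ha : 0 < a)
    (hB : (blockB ν b₀ u M).PosDef) :
    ∀ d : ℝ, 0 < d → ∀ l : Fin ν → ℝ,
      (nodeFactor ν a b₀ u M d l ≤
        nodeFactor ν a b₀ u M ((b₀ - u ⬝ᵥ (M⁻¹ *ᵥ u)) / a) (-(M⁻¹ *ᵥ u))) ∧
      (nodeFactor ν a b₀ u M d l =
          nodeFactor ν a b₀ u M ((b₀ - u ⬝ᵥ (M⁻¹ *ᵥ u)) / a) (-(M⁻¹ *ᵥ u)) ↔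
        d = (b₀ - u ⬝ᵥ (M⁻¹ *ᵥ u)) / a ∧ l = -(M⁻¹ *ᵥ u)) := by
  intro d hd l
  have hM : M.PosDef := by
    have h := hB.submatrix (e := Sum.inr) Sum.inr_injective
    exact h
  set w := M⁻¹ *ᵥ u
  set s := b₀ - u ⬝ᵥ w
  have hq (x : Fin ν → ℝ) :
      b₀ + 2 * (u ⬝ᵥ x) + x ⬝ᵥ (M *ᵥ x) = s + (x + w) ⬝ᵥ (M *ᵥ (x + w)) :=
    add_two_mul_dotProduct_add_eq hM b₀ u x
  have hmin : b₀ + 2 * (u ⬝ᵥ -w) + -w ⬝ᵥ (M *ᵥ -w) = s := by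
    rw [hq]; simp
  have hs : 0 < s := by
    have hne : Sum.elim (fun _ : Fin 1 => (1 : ℝ)) (-w) ≠ 0 := fun h => by
      simpa using congrFun h (Sum.inl 0)
    have h := hB.dotProduct_mulVec_pos hne
    rw [star_trivial, blockB_dotProduct_mulVec] at h
    linarith
  have hnonneg : 0 ≤ (l + w) ⬝ᵥ (M *ᵥ (l + w)) := by
    simpa using hM.posSemidef.dotProduct_mulVec_nonneg (l + w)
  have hzero : (l + w) ⬝ᵥ (M *ᵥ (l + w)) = 0 ↔ l = -w := by
    rw [← add_eq_zero_iff_eq_neg]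
    refine ⟨fun h => ?_, fun h => by simp [h]⟩
    by_contra hne
    have hpos := hM.dotProduct_mulVec_pos hne
    rw [star_trivial, h] at hpos
    exact lt_irrefl _ hpos
  have key := rpow_mul_exp_neg_div_le ha hd hs (le_add_of_nonneg_right hnonneg)
  rw [add_eq_left, hzero] at key
  rw [nodeFactor, nodeFactor, hmin, hq]
  exact key
end

section
/- Let p be a positive integer and pa : {1,…,p} → 2^{{1,…,p}} a parent map with j ∈ pa(i) ⟹ j > i (a DAG with parent ordering). Let Θ be the set of pairs (D, L) where D is diagonal with strictly positive diagonal entries and L is lower triangular with unit diagonal satisfying L_{ji} = 0 whenever j > i and j ∉ pa(i). Let Ũ be a p×p symmetric positive definite matrix and ã₁,…,ã_p > 0. For i with pa(i) ≠ ∅ let Ũ^{>i} be the submatrix (Ũ_{kj})_{k,j ∈ pa(i)} and Ũ_{·i}^> the vector (Ũ_{ji})_{j ∈ pa(i)}, and set Ũ_{i|pa(i)} = Ũ_{ii} − (Ũ_{·i}^>)ᵀ (Ũ^{>i})⁻¹ Ũ_{·i}^> (with Ũ_{i|pa(i)} = Ũ_{ii} when pa(i) = ∅). Then the function (D, L) ↦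 exp(−½ tr((L D⁻¹ Lᵀ) Ũ)) ∏_{i=1}^p D_{ii}^{−ã_i/2} on Θ attains its maximum uniquely at (D̂, L̂) ∈ Θ given by D̂_{ii} = Ũ_{i|pa(i)}/ã_i for every i, and, for each i with pa(i) ≠ ∅, the subvector (L̂_{ji})_{j ∈ pa(i)} equals −(Ũ^{>i})⁻¹ Ũ_{·i}^> (all other below-diagonal entries of L̂ being zero). -/
open Matrix

/-- The principal submatrix `Ũ^{>i} = (Ũ_{kj})_{k,j ∈ pa(i)}`. -/
def subMat (p : ℕ) (pa : Fin p → Finset (Fin p)) (Ut : Matrix (Fin p) (Fin p) ℝ)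
    (i : Fin p) : Matrix ↥(pa i) ↥(pa i) ℝ :=
  Matrix.of fun k j => Ut k.1 j.1

/-- The vector `Ũ_{·i}^> = (Ũ_{ji})_{j ∈ pa(i)}`. -/
def subCol (p : ℕ) (pa : Fin p → Finset (Fin p)) (Ut : Matrix (Fin p) (Fin p) ℝ)
    (i : Fin p) : ↥(pa i) → ℝ :=
  fun j => Ut j.1 i

/-- The Schur complement `Ũ_{i|pa(i)} = Ũ_{ii} - (Ũ_{·i}^>)ᵀ (Ũ^{>i})⁻¹ Ũ_{·i}^>`
(equal to `Ũ_{ii}` when `pa(i) = ∅`). -/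
noncomputable def schurC (p : ℕ) (pa : Fin p → Finset (Fin p))
    (Ut : Matrix (Fin p) (Fin p) ℝ) (i : Fin p) : ℝ :=
  Ut i i - subCol p pa Ut i ⬝ᵥ ((subMat p pa Ut i)⁻¹ *ᵥ subCol p pa Ut i)

/-- The MAP Cholesky factor `L̂`: unit diagonal, `(L̂_{ji})_{j ∈ pa(i)} = -(Ũ^{>i})⁻¹ Ũ_{·i}^>`,
and all other entries zero. -/
noncomputable def mapL (p : ℕ) (pa : Fin p → Finset (Fin p))
    (Ut : Matrix (Fin p) (Fin p) ℝ) : Matrix (Fin p) (Fin p) ℝ :=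
  Matrix.of fun j i =>
    if j = i then 1
    else if h : j ∈ pa i then -(((subMat p pa Ut i)⁻¹ *ᵥ subCol p pa Ut i) ⟨j, h⟩)
    else 0

/-- The unnormalized DAG-Wishart posterior density at the Cholesky parameter `(d, L)`. -/
noncomputable def dagWishartKernel (p : ℕ) (Ut : Matrix (Fin p) (Fin p) ℝ)
    (at_ : Fin p → ℝ) (d : Fin p → ℝ) (L : Matrix (Fin p) (Fin p) ℝ) : ℝ :=
  Real.exp (-(1 / 2) * ((L * (Matrix.diagonal d)⁻¹ * Lᵀ) * Ut).trace) *
    ∏ i, d i ^ (-(at_ i) / 2)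

/-- Column `i` of a matrix `L` enters the trace `tr(L D⁻¹ Lᵀ U)` through its quadratic form,
divided by `d i`. -/
lemma trace_mul_inv_diagonal_mul_transpose {n : Type*} [Fintype n] [DecidableEq n]
    (U L : Matrix n n ℝ) (d : n → ℝ) (hd : ∀ i, 0 < d i) :
    ((L * (diagonal d)⁻¹ * Lᵀ) * U).trace =
      ∑ i, (fun j => L j i) ⬝ᵥ (U *ᵥ fun j => L j i) / d i := by
  have hinv : (diagonal d)⁻¹ = diagonal fun i => (d i)⁻¹ := by
    refine inv_eq_right_inv ?_
    rw [diagonal_mul_diagonal, ← diagonal_one]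
    congr 1
    ext i
    exact mul_inv_cancel₀ (hd i).ne'
  rw [hinv, Matrix.mul_assoc, trace_mul_comm, ← Matrix.mul_assoc]
  simp only [trace, diag_apply, mul_diagonal]
  refine Finset.sum_congr rfl fun i _ => ?_
  rw [div_eq_mul_inv, Matrix.mul_assoc]
  rfl

/-- The logarithm of the factor contributed by one vertex: `d` is the conditional variance,
`q` the quadratic form of the column, `a` the shape parameter. -/
noncomputable def logFactor (a d q : ℝ) : ℝ := -(1 / 2) * (q / d) + Real.log d * (-a / 2)

lemma dagWishartKernel_eq_exp (p : ℕ) (U : Matrix (Fin p) (Fin p) ℝ) (a d : Fin p → ℝ)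
    (L : Matrix (Fin p) (Fin p) ℝ) (hd : ∀ i, 0 < d i) :
    dagWishartKernel p U a d L =
      Real.exp (∑ i, logFactor (a i) (d i) ((fun j => L j i) ⬝ᵥ (U *ᵥ fun j => L j i))) := by
  simp only [logFactor]
  rw [dagWishartKernel, trace_mul_inv_diagonal_mul_transpose U L d hd, Finset.sum_add_distrib,
    Real.exp_add, ← Finset.mul_sum, Real.exp_sum]
  congr 1
  exact Finset.prod_congr rfl fun i _ => Real.rpow_def_of_pos (hd i) _

lemma logFactor_le {a d s q : ℝ} (ha : 0 < a) (hd : 0 < d) (hs : 0 < s) (hq : s ≤ q) :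
    logFactor a d q ≤ logFactor a (s / a) s := by
  have ht : 0 < s / a / d := by positivity
  have hlog := Real.log_le_sub_one_of_pos ht
  rw [Real.log_div (by positivity) hd.ne'] at hlog
  have hqd : s / d ≤ q / d := by gcongr
  have h1 : a * (s / a / d) = s / d := by field_simp
  have h2 : s / (s / a) = a := by field_simp
  have hmul := mul_le_mul_of_nonneg_left hlog ha.le
  rw [logFactor, logFactor, h2]
  nlinarith

lemma eq_of_logFactor_eq {a d s q : ℝ} (ha : 0 < a) (hd : 0 < d) (hs : 0 < s) (hq : s ≤ q)
    (h : logFactor a d q = logFactor a (s / a) s) : d = s / a ∧ q = s := by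
  have hds : d = s / a := by
    by_contra hne
    have ht : 0 < s / a / d := by positivity
    have ht1 : s / a / d ≠ 1 := fun h1 => hne ((div_eq_one_iff_eq hd.ne').1 h1).symm
    have hlog := Real.log_lt_sub_one_of_pos ht ht1
    rw [Real.log_div (by positivity) hd.ne'] at hlog
    have hqd : s / d ≤ q / d := by gcongr
    have h1 : a * (s / a / d) = s / d := by field_simp
    have h2 : s / (s / a) = a := by field_simp
    have hmul := mul_lt_mul_of_pos_left hlog ha
    rw [logFactor, logFactor, h2] at h
    nlinarith
  refine ⟨hds, ?_⟩
  subst hds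
  have : q / (s / a) = s / (s / a) := by
    simp only [logFactor] at h
    linarith
  exact (div_left_inj' hd.ne').1 this

section

variable {p : ℕ} {pa : Fin p → Finset (Fin p)} {U : Matrix (Fin p) (Fin p) ℝ}

lemma mapL_self (i : Fin p) : mapL p pa U i i = 1 := by simp [mapL]

lemma mapL_of_notMem {i j : Fin p} (hji : j ≠ i) (hj : j ∉ pa i) : mapL p pa U j i = 0 := by
  simp [mapL, hji, hj]

/-- Multiplying `U` by column `i` of `mapL` only sees `i` and its parents. -/
lemma mulVec_mapL_apply (hpa : ∀ i, ∀ j ∈ pa i, i < j) (i k : Fin p) :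
    (U *ᵥ fun j => mapL p pa U j i) k =
      U k i - ∑ j : ↥(pa i), U k j.1 * ((subMat p pa U i)⁻¹ *ᵥ subCol p pa U i) j := by
  have hi : i ∉ pa i := fun h => lt_irrefl _ (hpa i i h)
  have hsupp : ∑ j, U k j * mapL p pa U j i =
      ∑ j ∈ insert i (pa i), U k j * mapL p pa U j i := by
    refine (Finset.sum_subset (Finset.subset_univ _) fun j _ hj => ?_).symm
    rw [Finset.mem_insert, not_or] at hj
    rw [mapL_of_notMem hj.1 hj.2, mul_zero]
  change ∑ j, U k j * mapL p pa U j i = _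
  rw [hsupp, Finset.sum_insert hi, mapL_self, mul_one, sub_eq_add_neg, ← Finset.sum_neg_distrib,
    ← Finset.sum_coe_sort (pa i)]
  congr 1
  refine Finset.sum_congr rfl fun j _ => ?_
  have hj : j.1 ≠ i := (hpa i j.1 j.2).ne'
  simp [mapL, hj]

lemma mulVec_mapL_apply_of_mem (hpa : ∀ i, ∀ j ∈ pa i, i < j) (hU : U.PosDef) {i k : Fin p}
    (hk : k ∈ pa i) : (U *ᵥ fun j => mapL p pa U j i) k = 0 := by
  have hsub : (subMat p pa U i).PosDef := hU.submatrix Subtype.val_injective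
  have hmul : subMat p pa U i *ᵥ ((subMat p pa U i)⁻¹ *ᵥ subCol p pa U i) = subCol p pa U i := by
    rw [mulVec_mulVec, mul_nonsing_inv _ ((isUnit_iff_isUnit_det _).1 hsub.isUnit), one_mulVec]
  rw [mulVec_mapL_apply hpa, sub_eq_zero]
  exact (congrFun hmul ⟨k, hk⟩).symm

lemma mulVec_mapL_apply_self (hpa : ∀ i, ∀ j ∈ pa i, i < j) (hU : U.PosDef) (i : Fin p) :
    (U *ᵥ fun j => mapL p pa U j i) i = schurC p pa U i := by
  rw [mulVec_mapL_apply hpa, schurC]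
  congr 1
  refine Finset.sum_congr rfl fun j _ => ?_
  rw [subCol, show U i j.1 = U j.1 i from (hU.isHermitian.apply i j.1).symm]

/-- For a vector supported on `i` and its parents, pairing with `U` times column `i` of `mapL`
extracts the `i`-th coordinate. -/
lemma dotProduct_mulVec_mapL (hpa : ∀ i, ∀ j ∈ pa i, i < j) (hU : U.PosDef) {i : Fin p}
    {x : Fin p → ℝ} (hx : ∀ j, j ≠ i → j ∉ pa i → x j = 0) :
    x ⬝ᵥ (U *ᵥ fun j => mapL p pa U j i) = x i * schurC p pa U i := by
  rw [dotProduct, Finset.sum_eq_single i, mulVec_mapL_apply_self hpa hU]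
  · intro j _ hji
    by_cases hj : j ∈ pa i
    · rw [mulVec_mapL_apply_of_mem hpa hU hj, mul_zero]
    · rw [hx j hji hj, zero_mul]
  · simp

lemma quadForm_mapL (hpa : ∀ i, ∀ j ∈ pa i, i < j) (hU : U.PosDef) (i : Fin p) :
    (fun j => mapL p pa U j i) ⬝ᵥ (U *ᵥ fun j => mapL p pa U j i) = schurC p pa U i := by
  rw [dotProduct_mulVec_mapL hpa hU fun j => mapL_of_notMem, mapL_self, one_mul]

lemma schurC_pos (hpa : ∀ i, ∀ j ∈ pa i, i < j) (hU : U.PosDef) (i : Fin p) :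
    0 < schurC p pa U i := by
  have hne : (fun j => mapL p pa U j i) ≠ 0 := fun h =>
    one_ne_zero ((mapL_self i).symm.trans (congrFun h i))
  simpa [quadForm_mapL hpa hU] using hU.dotProduct_mulVec_pos hne

/-- Completing the square around column `i` of `mapL`. -/
lemma quadForm_eq_schurC_add (hpa : ∀ i, ∀ j ∈ pa i, i < j) (hU : U.PosDef) {i : Fin p}
    {x : Fin p → ℝ} (hxi : x i = 1) (hx : ∀ j, j ≠ i → j ∉ pa i → x j = 0) :
    x ⬝ᵥ (U *ᵥ x) = schurC p pa U i +
      (x - fun j => mapL p pa U j i) ⬝ᵥ (U *ᵥ (x - fun j => mapL p pa U j i)) := by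
  have hUt : Uᵀ = U := by simpa using hU.isHermitian.eq
  have hsymm : (fun j => mapL p pa U j i) ⬝ᵥ (U *ᵥ x) =
      x ⬝ᵥ (U *ᵥ fun j => mapL p pa U j i) := by
    rw [dotProduct_mulVec, ← mulVec_transpose, hUt, dotProduct_comm]
  rw [mulVec_sub, dotProduct_sub, sub_dotProduct, sub_dotProduct, hsymm, quadForm_mapL hpa hU,
    dotProduct_mulVec_mapL hpa hU hx, hxi]
  ring

lemma schurC_le_quadForm (hpa : ∀ i, ∀ j ∈ pa i, i < j) (hU : U.PosDef) {i : Fin p}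
    {x : Fin p → ℝ} (hxi : x i = 1) (hx : ∀ j, j ≠ i → j ∉ pa i → x j = 0) :
    schurC p pa U i ≤ x ⬝ᵥ (U *ᵥ x) := by
  rw [quadForm_eq_schurC_add hpa hU hxi hx]
  simpa using hU.posSemidef.dotProduct_mulVec_nonneg (x - fun j => mapL p pa U j i)

lemma eq_mapL_of_quadForm_eq (hpa : ∀ i, ∀ j ∈ pa i, i < j) (hU : U.PosDef) {i : Fin p}
    {x : Fin p → ℝ} (hxi : x i = 1) (hx : ∀ j, j ≠ i → j ∉ pa i → x j = 0)
    (h : x ⬝ᵥ (U *ᵥ x) = schurC p pa U i) : x = fun j => mapL p pa U j i := by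
  rw [quadForm_eq_schurC_add hpa hU hxi hx, add_eq_left] at h
  by_contra hne
  have hpos := hU.dotProduct_mulVec_pos (sub_ne_zero.2 hne)
  rw [star_trivial, h] at hpos
  exact lt_irrefl _ hpos

end

/-- MAP characterization (Proposition 1): over the Cholesky space of a DAG with parent
ordering `pa`, the unnormalized DAG-Wishart posterior density attains its maximum
uniquely at `D̂_{ii} = Ũ_{i|pa(i)} / ã_i` and `(L̂_{ji})_{j ∈ pa(i)} = -(Ũ^{>i})⁻¹ Ũ_{·i}^>`. -/
theorem dagWishart_MAP (p : ℕ) (pa : Fin p → Finset (Fin p))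
    (hpa : ∀ i, ∀ j ∈ pa i, i < j)
    (Ut : Matrix (Fin p) (Fin p) ℝ) (hUt : Ut.PosDef)
    (at_ : Fin p → ℝ) (hat : ∀ i, 0 < at_ i) :
    -- the maximizer lies in the Cholesky space Θ
    ((∀ i, 0 < schurC p pa Ut i / at_ i) ∧
      (∀ i, mapL p pa Ut i i = 1) ∧
      (∀ i j, i < j → mapL p pa Ut i j = 0) ∧
      (∀ j i, i < j → j ∉ pa i → mapL p pa Ut j i = 0)) ∧
    -- it is the unique maximum over Θ
    (∀ (d : Fin p → ℝ) (L : Matrix (Fin p) (Fin p) ℝ),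
      (∀ i, 0 < d i) → (∀ i, L i i = 1) → (∀ i j, i < j → L i j = 0) →
      (∀ j i, i < j → j ∉ pa i → L j i = 0) →
      dagWishartKernel p Ut at_ d L ≤
        dagWishartKernel p Ut at_ (fun i => schurC p pa Ut i / at_ i) (mapL p pa Ut) ∧
      (dagWishartKernel p Ut at_ d L =
          dagWishartKernel p Ut at_ (fun i => schurC p pa Ut i / at_ i) (mapL p pa Ut) →
        d = (fun i => schurC p pa Ut i / at_ i) ∧ L = mapL p pa Ut)) := by
  have hs := schurC_pos hpa hUt
  have hd' : ∀ i, 0 < schurC p pa Ut i / at_ i := fun i => div_pos (hs i) (hat i)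
  refine ⟨⟨hd', mapL_self, fun i j hij => mapL_of_notMem hij.ne fun h => (hpa j i h).asymm hij,
    fun j i hij hj => mapL_of_notMem hij.ne' hj⟩, fun d L hd hdiag hupper hlower => ?_⟩
  have hcol : ∀ i j, j ≠ i → j ∉ pa i → L j i = 0 := fun i j hji hj =>
    hji.lt_or_gt.elim (hupper j i) fun hij => hlower j i hij hj
  have hq i := schurC_le_quadForm hpa hUt (x := fun j => L j i) (hdiag i) (hcol i)
  have hle i := logFactor_le (hat i) (hd i) (hs i) (hq i)
  rw [dagWishartKernel_eq_exp p Ut at_ d L hd, dagWishartKernel_eq_exp p Ut at_ _ _ hd']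
  simp only [quadForm_mapL hpa hUt]
  refine ⟨Real.exp_le_exp.2 (Finset.sum_le_sum fun i _ => hle i), fun h => ?_⟩
  have heq := (Finset.sum_eq_sum_iff_of_le fun i _ => hle i).1 (Real.exp_injective h)
  have hmax i := eq_of_logFactor_eq (hat i) (hd i) (hs i) (hq i) (heq i (Finset.mem_univ i))
  refine ⟨funext fun i => (hmax i).1, ?_⟩
  ext j i
  exact congrFun (eq_mapL_of_quadForm_eq hpa hUt (x := fun j => L j i) (hdiag i) (hcol i)
    (hmax i).2) j
end

section
/- Let ν ≥ 0, let B be a real symmetric positive definite (ν+1)×(ν+1) matrix written in block form B = [[b₀, uᵀ],[u, M]] with b₀ ∈ ℝ, u ∈ ℝ^ν, M a ν×ν matrix, and let a > ν + 2. Then ∫₀^∞ ∫_{ℝ^ν} d^{−a/2} exp(−(b₀ + 2 uᵀ l + lᵀ M l)/(2d)) dl dd = Γ(a/2 − ν/2 − 1) · 2^{a/2 − 1} · π^{ν/2} · det(M)^{a/2 − ν/2 − 3/2} / det(B)^{a/2 − ν/2 − 1}. -/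
open Matrix MeasureTheory

open scoped MatrixOrder in
/-- A real positive definite matrix factors as `Aᵀ * A` with `A` invertible. -/
theorem Matrix.PosDef.exists_transpose_mul_self {ι : Type*} [Fintype ι] [DecidableEq ι]
    {M : Matrix ι ι ℝ} (hM : M.PosDef) : ∃ A : Matrix ι ι ℝ, A.det ≠ 0 ∧ M = Aᵀ * A := by
  obtain ⟨A, hA, rfl⟩ := CStarAlgebra.isStrictlyPositive_iff_eq_star_mul_self.mp
    hM.isStrictlyPositive
  refine ⟨A, ((Matrix.isUnit_iff_isUnit_det A).mp hA).ne_zero, ?_⟩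
  rw [star_eq_conjTranspose, conjTranspose_eq_transpose_of_trivial]

/-- Linear change of variables for a continuous integrand. -/
theorem integral_comp_mulVec {ι : Type*} [Fintype ι] [DecidableEq ι] {A : Matrix ι ι ℝ}
    (hA : A.det ≠ 0) {f : (ι → ℝ) → ℝ} (hf : Continuous f) :
    ∫ l, f (A *ᵥ l) = |A.det|⁻¹ * ∫ y, f y := by
  have hmeas : AEMeasurable (Matrix.toLin' A) (volume : Measure (ι → ℝ)) :=
    (LinearMap.continuous_on_pi _).aemeasurable
  have h := integral_map hmeas (hf.aestronglyMeasurable (μ := Measure.map (toLin' A) volume))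
  rw [Real.map_matrix_volume_pi_eq_smul_volume_pi hA, integral_smul_measure,
    ENNReal.toReal_ofReal (abs_nonneg _), abs_inv, smul_eq_mul] at h
  simpa only [Matrix.toLin'_apply] using h.symm

/-- The standard Gaussian integral on `ι → ℝ`. -/
theorem integral_exp_neg_mul_dotProduct_self {ι : Type*} [Fintype ι] {k : ℝ} (hk : 0 < k) :
    ∫ y : ι → ℝ, Real.exp (-k * (y ⬝ᵥ y)) = (Real.pi / k) ^ ((Fintype.card ι : ℝ) / 2) := by
  have h (y : ι → ℝ) : Real.exp (-k * (y ⬝ᵥ y)) = ∏ i, Real.exp (-k * y i ^ 2) := by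
    rw [← Real.exp_sum, dotProduct, Finset.mul_sum]
    simp only [pow_two]
  simp_rw [h]
  rw [integral_fintype_prod_volume_eq_pow (fun x : ℝ => Real.exp (-k * x ^ 2)),
    integral_gaussian, Real.sqrt_eq_rpow, ← Real.rpow_natCast, ← Real.rpow_mul (by positivity)]
  congr 1
  ring

/-- The Gaussian integral of a positive definite quadratic form. -/
theorem Matrix.PosDef.integral_exp_neg_mul_dotProduct_mulVec {ι : Type*} [Fintype ι]
    [DecidableEq ι] {M : Matrix ι ι ℝ} (hM : M.PosDef) {k : ℝ} (hk : 0 < k) :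
    ∫ l : ι → ℝ, Real.exp (-k * (l ⬝ᵥ (M *ᵥ l))) =
      (Real.pi / k) ^ ((Fintype.card ι : ℝ) / 2) * M.det ^ (-(1 / 2) : ℝ) := by
  obtain ⟨A, hA, rfl⟩ := hM.exists_transpose_mul_self
  have h (l : ι → ℝ) : l ⬝ᵥ ((Aᵀ * A) *ᵥ l) = (A *ᵥ l) ⬝ᵥ (A *ᵥ l) := by
    rw [← mulVec_mulVec, dotProduct_mulVec, vecMul_transpose]
  simp_rw [h]
  rw [integral_comp_mulVec hA (f := fun y => Real.exp (-k * (y ⬝ᵥ y)))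
      (by unfold dotProduct; fun_prop),
    integral_exp_neg_mul_dotProduct_self hk, det_mul, det_transpose, mul_comm,
    Real.rpow_neg (mul_self_nonneg _), ← Real.sqrt_eq_rpow, Real.sqrt_mul_self_eq_abs]

/-- Completing the square for a symmetric invertible matrix. -/
theorem Matrix.add_two_mul_dotProduct_add_dotProduct_mulVec {ι : Type*} [Fintype ι]
    [DecidableEq ι] {M : Matrix ι ι ℝ} (hsymm : Mᵀ = M) (hM : IsUnit M.det) (b : ℝ)
    (u l : ι → ℝ) :
    b + 2 * (u ⬝ᵥ l) + l ⬝ᵥ (M *ᵥ l) = (b - u ⬝ᵥ (M⁻¹ *ᵥ u)) +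
      (l + M⁻¹ *ᵥ u) ⬝ᵥ (M *ᵥ (l + M⁻¹ *ᵥ u)) := by
  have hw : M *ᵥ (M⁻¹ *ᵥ u) = u := by
    rw [mulVec_mulVec, mul_nonsing_inv _ hM, one_mulVec]
  have hwl : (M⁻¹ *ᵥ u) ⬝ᵥ (M *ᵥ l) = u ⬝ᵥ l := by
    rw [dotProduct_mulVec, ← mulVec_transpose, hsymm, hw]
  rw [mulVec_add, hw, dotProduct_add, add_dotProduct, add_dotProduct, hwl,
    dotProduct_comm l u, dotProduct_comm (M⁻¹ *ᵥ u) u]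
  ring

/-- The normalizing integral of the inverse-gamma density. -/
theorem Real.integral_rpow_neg_mul_exp_neg_div_Ioi {s c : ℝ} (hs : 0 < s) (hc : 0 < c) :
    ∫ x in Set.Ioi (0 : ℝ), x ^ (-s - 1) * Real.exp (-(c / x)) =
      (1 / c) ^ s * Real.Gamma s := by
  rw [← Real.integral_rpow_mul_exp_neg_mul_Ioi hs hc,
    ← integral_comp_rpow_Ioi (fun y => y ^ (s - 1) * Real.exp (-(c * y)))
      (p := -1) (by norm_num)]
  refine setIntegral_congr_fun measurableSet_Ioi fun x hx => ?_
  have hx : 0 < x := hx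
  simp only [abs_neg, abs_one, one_mul, smul_eq_mul]
  rw [← Real.rpow_mul hx.le, ← mul_assoc, ← Real.rpow_add hx, Real.rpow_neg_one,
    div_eq_mul_inv]
  congr 2
  ring

theorem det_blockB {ν : ℕ} (b₀ : ℝ) (u : Fin ν → ℝ) {M : Matrix (Fin ν) (Fin ν) ℝ}
    (hM : IsUnit M.det) :
    (blockB ν b₀ u M).det = M.det * (b₀ - u ⬝ᵥ (M⁻¹ *ᵥ u)) := by
  let := M.invertibleOfIsUnitDet hM
  rw [blockB, det_fromBlocks₂₂, det_fin_one, invOf_eq_nonsing_inv, Matrix.mul_assoc]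
  rfl

theorem posDef_of_posDef_blockB {ν : ℕ} {b₀ : ℝ} {u : Fin ν → ℝ}
    {M : Matrix (Fin ν) (Fin ν) ℝ} (hB : (blockB ν b₀ u M).PosDef) : M.PosDef :=
  hB.submatrix Sum.inr_injective

/-- The `i`-th factor of the DAG-Wishart normalizing constant: for a symmetric positive
definite block matrix `B = [[b₀, uᵀ], [u, M]]` and `a > ν + 2`,
`∫₀^∞ ∫_{ℝ^ν} d^(-a/2) exp (-(b₀ + 2 uᵀ l + lᵀ M l)/(2d)) dl dd
  = Γ(a/2 - ν/2 - 1) 2^(a/2 - 1) π^(ν/2) det(M)^(a/2 - ν/2 - 3/2) / det(B)^(a/2 - ν/2 - 1)`. -/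
theorem dagWishart_normalizing_factor (ν : ℕ) (b₀ : ℝ) (u : Fin ν → ℝ)
    (M : Matrix (Fin ν) (Fin ν) ℝ) (a : ℝ) (ha : (ν : ℝ) + 2 < a)
    (hB : (blockB ν b₀ u M).PosDef) :
    (∫ d in Set.Ioi (0 : ℝ), ∫ l : Fin ν → ℝ,
        d ^ (-a / 2) * Real.exp (-(b₀ + 2 * (u ⬝ᵥ l) + l ⬝ᵥ (M *ᵥ l)) / (2 * d)))
      = Real.Gamma (a / 2 - (ν : ℝ) / 2 - 1) * 2 ^ (a / 2 - 1) *
          Real.pi ^ ((ν : ℝ) / 2) * M.det ^ (a / 2 - (ν : ℝ) / 2 - 3 / 2) /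
          (blockB ν b₀ u M).det ^ (a / 2 - (ν : ℝ) / 2 - 1) := by
  have hM := posDef_of_posDef_blockB hB
  have hMdet := hM.det_pos
  have hBdet := hB.det_pos
  have hunit : IsUnit M.det := hMdet.ne'.isUnit
  have hsymm : Mᵀ = M := by
    simpa [conjTranspose_eq_transpose_of_trivial] using hM.isHermitian.eq
  rw [det_blockB b₀ u hunit] at hBdet ⊢
  set c := b₀ - u ⬝ᵥ (M⁻¹ *ᵥ u) with hc_def
  have hc : 0 < c := pos_of_mul_pos_right hBdet hMdet.le
  set s := a / 2 - (ν : ℝ) / 2 - 1 with hs_def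
  have hs : 0 < s := by rw [hs_def]; linarith
  have hinner : ∀ d ∈ Set.Ioi (0 : ℝ), ∫ l : Fin ν → ℝ,
      d ^ (-a / 2) * Real.exp (-(b₀ + 2 * (u ⬝ᵥ l) + l ⬝ᵥ (M *ᵥ l)) / (2 * d)) =
      ((2 * Real.pi) ^ ((ν : ℝ) / 2) * M.det ^ (-(1 / 2) : ℝ)) *
        (d ^ (-s - 1) * Real.exp (-(c / 2 / d))) := by
    intro d hd
    have hd : 0 < d := hd
    have hexp (l : Fin ν → ℝ) :
        Real.exp (-(b₀ + 2 * (u ⬝ᵥ l) + l ⬝ᵥ (M *ᵥ l)) / (2 * d)) =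
        Real.exp (-(c / 2 / d)) *
          Real.exp (-(1 / (2 * d)) * ((l + M⁻¹ *ᵥ u) ⬝ᵥ (M *ᵥ (l + M⁻¹ *ᵥ u)))) := by
      rw [add_two_mul_dotProduct_add_dotProduct_mulVec hsymm hunit, ← Real.exp_add]
      congr 1
      field_simp
      ring
    simp_rw [hexp]
    rw [integral_const_mul, integral_const_mul,
      integral_add_right_eq_self
        (fun l => Real.exp (-(1 / (2 * d)) * (l ⬝ᵥ (M *ᵥ l)))) (M⁻¹ *ᵥ u),
      hM.integral_exp_neg_mul_dotProduct_mulVec (by positivity), Fintype.card_fin,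
      show Real.pi / (1 / (2 * d)) = (2 * Real.pi) * d by field_simp,
      Real.mul_rpow (by positivity) hd.le,
      show -s - 1 = -a / 2 + (ν : ℝ) / 2 by rw [hs_def]; ring, Real.rpow_add hd]
    ring
  rw [setIntegral_congr_fun measurableSet_Ioi hinner, integral_const_mul,
    Real.integral_rpow_neg_mul_exp_neg_div_Ioi hs (half_pos hc), one_div_div,
    Real.div_rpow zero_le_two hc.le, Real.mul_rpow zero_le_two Real.pi_pos.le,
    Real.mul_rpow hMdet.le hc.le,
    show a / 2 - 1 = (ν : ℝ) / 2 + s by rw [hs_def]; ring, Real.rpow_add two_pos,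
    show a / 2 - (ν : ℝ) / 2 - 3 / 2 = s + -(1 / 2) by rw [hs_def]; ring,
    Real.rpow_add hMdet]
  have h₁ : M.det ^ s ≠ 0 := by positivity
  have h₂ : c ^ s ≠ 0 := by positivity
  field_simp
end

section
/- Let Ω be a p×p real symmetric positive definite matrix all of whose eigenvalues lie in the interval [a, b] with 0 < a ≤ b, and let Ω = L D⁻¹ Lᵀ be its modified Cholesky decomposition (L lower triangular with unit diagonal, D diagonal with positive diagonal). Then 1/b ≤ D_{ii} ≤ 1/a for every i ∈ {1,…,p}. -/
open Matrix

open scoped MatrixOrder in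
/-- A lower bound on the eigenvalues of a Hermitian matrix bounds its quadratic form from below. -/
theorem Matrix.IsHermitian.mul_dotProduct_self_le {n : Type*} [Fintype n] [DecidableEq n]
    {A : Matrix n n ℝ} (hA : A.IsHermitian) {a : ℝ} (h : ∀ i, a ≤ hA.eigenvalues i)
    (x : n → ℝ) : a * (x ⬝ᵥ x) ≤ x ⬝ᵥ (A *ᵥ x) := by
  have hle : algebraMap ℝ (Matrix n n ℝ) a ≤ A := by
    refine algebraMap_le_of_le_spectrum (fun r hr => ?_) hA.isSelfAdjoint
    obtain ⟨i, rfl⟩ := hA.spectrum_real_eq_range_eigenvalues ▸ hr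
    exact h i
  have := (Matrix.le_iff.mp hle).dotProduct_mulVec_nonneg x
  simpa [sub_mulVec, Algebra.algebraMap_eq_smul_one, smul_mulVec] using this

open scoped MatrixOrder in
/-- An upper bound on the eigenvalues of a Hermitian matrix bounds its diagonal from above. -/
theorem Matrix.IsHermitian.diag_le {n : Type*} [Fintype n] [DecidableEq n]
    {A : Matrix n n ℝ} (hA : A.IsHermitian) {b : ℝ} (h : ∀ i, hA.eigenvalues i ≤ b)
    (i : n) : A i i ≤ b := by
  have hle : A ≤ algebraMap ℝ (Matrix n n ℝ) b := by
    refine le_algebraMap_of_spectrum_le (fun r hr => ?_) hA.isSelfAdjoint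
    obtain ⟨i, rfl⟩ := hA.spectrum_real_eq_range_eigenvalues ▸ hr
    exact h i
  simpa [algebraMap_matrix_apply] using (Matrix.le_iff.mp hle).diag_nonneg (i := i)

/-- For a unit lower triangular matrix `L`, the solution of `Lᵀ x = eᵢ` satisfies `xᵢ = 1`. -/
theorem exists_transpose_mulVec_eq_single {n : Type*} [Fintype n] [LinearOrder n]
    {L : Matrix n n ℝ} (hL : ∀ i j, i < j → L i j = 0) (hdiag : ∀ i, L i i = 1) (i : n) :
    ∃ x : n → ℝ, Lᵀ *ᵥ x = Pi.single i 1 ∧ x i = 1 := by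
  have hT : Lᵀ.BlockTriangular id := fun k l hkl => hL l k hkl
  have hdet : IsUnit Lᵀ.det := by
    rw [det_of_isUpperTriangular hT]
    simp [hdiag]
  let _ := invertibleOfIsUnitDet _ hdet
  have hinv := blockTriangular_inv_of_blockTriangular hT
  have hx : Lᵀ *ᵥ ((Lᵀ)⁻¹ *ᵥ Pi.single i 1) = Pi.single i 1 := by
    rw [mulVec_mulVec, mul_nonsing_inv _ hdet, one_mulVec]
  refine ⟨_, hx, ?_⟩
  have hi := congrFun hx i
  rw [mulVec, dotProduct, Finset.sum_eq_single i] at hi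
  · simpa [hdiag] using hi
  · intro k _ hk
    rcases lt_or_gt_of_ne hk with hk | hk
    · simp [hL k i hk]
    · have : (Lᵀ)⁻¹ k i = 0 := hinv hk
      simp [this]
  · simp

/-- If the eigenvalues of a symmetric positive definite matrix `Ω` all lie in `[a, b]`
with `0 < a ≤ b`, and `Ω = L D⁻¹ Lᵀ` is its modified Cholesky decomposition, then
`1/b ≤ D_{ii} ≤ 1/a` for every `i`. -/
theorem mcd_diag_bounds (p : ℕ) (Ω : Matrix (Fin p) (Fin p) ℝ) (hΩ : Ω.PosDef)
    (a b : ℝ) (ha : 0 < a) (hab : a ≤ b)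
    (heig : ∀ i, hΩ.isHermitian.eigenvalues i ∈ Set.Icc a b)
    (L : Matrix (Fin p) (Fin p) ℝ) (d : Fin p → ℝ)
    (hL : ∀ i j, i < j → L i j = 0) (hdiag : ∀ i, L i i = 1) (hd : ∀ i, 0 < d i)
    (hdecomp : Ω = L * (Matrix.diagonal d)⁻¹ * Lᵀ) :
    ∀ i, 1 / b ≤ d i ∧ d i ≤ 1 / a := by
  intro i
  have hDinv : (Matrix.diagonal d)⁻¹ = Matrix.diagonal fun j => (d j)⁻¹ := by
    refine inv_eq_left_inv ?_
    simp [diagonal_mul_diagonal, (hd _).ne']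
  rw [hDinv] at hdecomp
  constructor
  · rw [one_div_le (ha.trans_le hab) (hd i)]
    refine le_trans ?_ (hΩ.isHermitian.diag_le (fun j => (heig j).2) i)
    have hsum : Ω i i = ∑ j, L i j * (d j)⁻¹ * L i j := by
      rw [hdecomp, mul_apply]
      simp [mul_diagonal]
    rw [hsum]
    refine le_trans (by simp [hdiag]) (Finset.single_le_sum
      (f := fun j => L i j * (d j)⁻¹ * L i j) (fun j _ => ?_) (Finset.mem_univ i))
    rw [mul_right_comm]
    exact mul_nonneg (mul_self_nonneg _) (inv_nonneg.mpr (hd j).le)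
  · rw [le_one_div (hd i) ha]
    obtain ⟨x, hx, hxi⟩ := exists_transpose_mulVec_eq_single hL hdiag i
    have hquad : x ⬝ᵥ (Ω *ᵥ x) = 1 / d i := by
      rw [hdecomp, ← mulVec_mulVec, hx, ← mulVec_mulVec, dotProduct_mulVec,
        ← mulVec_transpose, hx]
      simp
    have hnorm : 1 ≤ x ⬝ᵥ x := by
      refine le_trans (by simp [hxi]) (Finset.single_le_sum
        (f := fun j => x j * x j) (fun j _ => mul_self_nonneg _) (Finset.mem_univ i))
    rw [← hquad]
    exact (le_mul_of_one_le_right ha.le hnorm).trans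
      (hΩ.isHermitian.mul_dotProduct_self_le (fun j => (heig j).1) x)
end
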